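/- arXiv:math/0311400 — 3 statements merged into one kernel-verified Lean document; each statement's English description precedes it below -/
import Mathlib

section
/- Let γ > 0 and δ be real numbers with 0 < δ < 2 and δ ≠ 1. Let e, f ∈ B be idempotents, each of central charge γ and each having the fusion property of binary type with respect to δ, such that f ∈ B^e(0) ⊕ B^e(δ) ⊕ ℂe and e ∈ B^f(0) ⊕ B^f(δ) ⊕ ℂf. Then at least one of the following holds: (1) (e|f) = γ/2 and e = f; (2) (e|f) = 0 and e·f = 0; (3) (e|f) = δγ/8 and σ_e(f) = σ_f(e). -/
variable {B : Type*} [AddCommGroup B] [Module ℂ B]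

/-- The eigenspace `B^e(h) = {v ∈ B : (e|v) = 0 and e·v = h·v}`. -/
def eigSp (mul : B →ₗ[ℂ] B →ₗ[ℂ] B) (form : B →ₗ[ℂ] B →ₗ[ℂ] ℂ) (e : B) (h : ℂ) :
    Submodule ℂ B where
  carrier := {v | form e v = 0 ∧ mul e v = h • v}
  add_mem' := by
    intro a b ha hb
    exact ⟨by rw [map_add, ha.1, hb.1, add_zero], by rw [map_add, ha.2, hb.2, smul_add]⟩
  zero_mem' := ⟨by simp, by simp⟩
  smul_mem' := by
    intro c a ha
    exact ⟨by rw [map_smul, ha.1, smul_zero], by rw [map_smul, ha.2, smul_comm]⟩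

/-- The subspace `B_e[0] = B^e(0) ⊕ ℂe`. -/
def beBar (mul : B →ₗ[ℂ] B →ₗ[ℂ] B) (form : B →ₗ[ℂ] B →ₗ[ℂ] ℂ) (e : B) : Submodule ℂ B :=
  eigSp mul form e 0 ⊔ Submodule.span ℂ {e}

/-- The fusion property of binary type of the idempotent `e` with respect to the
spectrum `δ`: writing `B_e[0] = B^e(0) ⊕ ℂe` and `B_e[1] = B^e(δ)`, one has
`B_e[ε₁]·B_e[ε₂] ⊆ B_e[ε₁+ε₂]`. -/
def HasFusion (mul : B →ₗ[ℂ] B →ₗ[ℂ] B) (form : B →ₗ[ℂ] B →ₗ[ℂ] ℂ) (e : B) (δ : ℂ) : Prop :=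
  (∀ x ∈ beBar mul form e, ∀ y ∈ beBar mul form e, mul x y ∈ beBar mul form e) ∧
  (∀ x ∈ beBar mul form e, ∀ y ∈ eigSp mul form e δ, mul x y ∈ eigSp mul form e δ) ∧
  (∀ x ∈ eigSp mul form e δ, ∀ y ∈ beBar mul form e, mul x y ∈ eigSp mul form e δ) ∧
  (∀ x ∈ eigSp mul form e δ, ∀ y ∈ eigSp mul form e δ, mul x y ∈ beBar mul form e)

theorem eq_zero_of_mem_beBar_of_mem_eigSp
    {mul : B →ₗ[ℂ] B →ₗ[ℂ] B} {form : B →ₗ[ℂ] B →ₗ[ℂ] ℂ} {e x : B} {δ : ℂ}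
    (hee : form e e ≠ 0) (hδ : δ ≠ 0)
    (hx : x ∈ beBar mul form e) (hxδ : x ∈ eigSp mul form e δ) : x = 0 := by
  obtain ⟨z, ⟨hz, hmz⟩, w, hw, rfl⟩ := Submodule.mem_sup.1 hx
  obtain ⟨t, rfl⟩ := Submodule.mem_span_singleton.1 hw
  obtain ⟨h, hm⟩ := hxδ
  have ht : t = 0 := by simpa [hz, hee] using h
  subst ht
  simpa [hmz, hδ, eq_comm] using hm

/-- Multiplication by an idempotent on its `B^e(0) ⊕ B^e(δ) ⊕ ℂe`. -/
theorem mul_eq_of_decomposition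
    {mul : B →ₗ[ℂ] B →ₗ[ℂ] B} {form : B →ₗ[ℂ] B →ₗ[ℂ] ℂ} {e f f₀ fδ : B} {c δ : ℂ}
    (he : mul e e = (2 : ℂ) • e)
    (hf₀ : f₀ ∈ eigSp mul form e 0) (hfδ : fδ ∈ eigSp mul form e δ)
    (hfdec : f = f₀ + fδ + c • e) : mul e f = δ • fδ + (2 * c) • e := by
  rw [hfdec, map_add, map_add, map_smul, he, hf₀.2, hfδ.2]
  module

/-- The `δ`-component `fδ` of an idempotent `f` satisfies `f·fδ = fδ + fδ·fδ`. -/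
theorem idempotent_mul_component
    {mul : B →ₗ[ℂ] B →ₗ[ℂ] B} (hcomm : ∀ x y : B, mul x y = mul y x)
    {form : B →ₗ[ℂ] B →ₗ[ℂ] ℂ} {e f f₀ fδ : B} {c δ : ℂ}
    (hee : form e e ≠ 0) (hδ : δ ≠ 0)
    (he : mul e e = (2 : ℂ) • e) (hf : mul f f = (2 : ℂ) • f)
    (hfus : HasFusion mul form e δ)
    (hf₀ : f₀ ∈ eigSp mul form e 0) (hfδ : fδ ∈ eigSp mul form e δ)
    (hfdec : f = f₀ + fδ + c • e) : mul f fδ = fδ + mul fδ fδ := by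
  obtain ⟨h00, h01, -, h11⟩ := hfus
  have hf₀' : f₀ ∈ beBar mul form e := Submodule.mem_sup_left hf₀
  have he' : e ∈ beBar mul form e :=
    Submodule.mem_sup_right (Submodule.mem_span_singleton_self e)
  have hff : mul f₀ f₀ + (2 : ℂ) • mul f₀ fδ + (2 * δ * c) • fδ + mul fδ fδ
      + (2 * c ^ 2) • e = (2 : ℂ) • (f₀ + fδ + c • e) := by
    have h := hf
    rw [hfdec] at h
    rw [← h]
    simp only [map_add, map_smul, LinearMap.add_apply, LinearMap.smul_apply, he, hf₀.2, hfδ.2,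
      hcomm f₀ e, hcomm fδ e, hcomm fδ f₀]
    module
  have key : (2 : ℂ) • mul f₀ fδ + (2 * δ * c - 2) • fδ = 0 := by
    refine eq_zero_of_mem_beBar_of_mem_eigSp hee hδ ?_
      (add_mem (Submodule.smul_mem _ _ (h01 _ hf₀' _ hfδ)) (Submodule.smul_mem _ _ hfδ))
    have h : (2 : ℂ) • mul f₀ fδ + (2 * δ * c - 2) • fδ
        = (2 : ℂ) • f₀ + (2 * c - 2 * c ^ 2) • e - mul f₀ f₀ - mul fδ fδ := by
      linear_combination (norm := module) hff
    rw [h]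
    exact sub_mem (sub_mem (add_mem (Submodule.smul_mem _ _ hf₀') (Submodule.smul_mem _ _ he'))
      (h00 _ hf₀' _ hf₀')) (h11 _ hfδ _ hfδ)
  rw [hfdec]
  simp only [map_add, map_smul, LinearMap.add_apply, LinearMap.smul_apply, hfδ.2]
  linear_combination (norm := module) (1 / 2 : ℂ) • key

theorem smul_component_eq_zero
    {mul : B →ₗ[ℂ] B →ₗ[ℂ] B} (hcomm : ∀ x y : B, mul x y = mul y x)
    {form : B →ₗ[ℂ] B →ₗ[ℂ] ℂ} {e f f₀ fδ eδ : B} {c δ : ℂ}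
    (hee : form e e ≠ 0) (hδ : δ ≠ 0)
    (he : mul e e = (2 : ℂ) • e) (hf : mul f f = (2 : ℂ) • f)
    (hfus : HasFusion mul form e δ)
    (hf₀ : f₀ ∈ eigSp mul form e 0) (hfδ : fδ ∈ eigSp mul form e δ)
    (hfdec : f = f₀ + fδ + c • e)
    (heδ : mul f eδ = δ • eδ) (hfe : mul f e = δ • eδ + (2 * c) • f) :
    ((δ - 1) * (δ - 4 * c)) • fδ = 0 := by
  have hef := mul_eq_of_decomposition he hf₀ hfδ hfdec
  have hsq := idempotent_mul_component hcomm hee hδ he hf hfus hf₀ hfδ hfdec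
  have hp : δ • eδ + (2 * c) • f = δ • fδ + (2 * c) • e := by rw [← hfe, hcomm, hef]
  have hmul := congrArg (mul f) hp
  simp only [map_add, map_smul, heδ, hf, hfe, hsq] at hmul
  refine eq_zero_of_mem_beBar_of_mem_eigSp hee hδ ?_ (Submodule.smul_mem _ _ hfδ)
  have h : ((δ - 1) * (δ - 4 * c)) • fδ = δ • mul fδ fδ - (4 * c - 2 * c * δ) • f₀
      - ((δ - 2 * c - 1) * (2 * c) + (4 * c - 2 * c * δ) * c + 2 * c) • e := by
    subst hfdec
    linear_combination (norm := module) hmul - (δ - 2 * c) • hp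
  rw [h]
  exact sub_mem (sub_mem (Submodule.smul_mem _ _ (hfus.2.2.2 _ hfδ _ hfδ))
    (Submodule.smul_mem _ _ (Submodule.mem_sup_left hf₀)))
    (Submodule.smul_mem _ _ (Submodule.mem_sup_right (Submodule.mem_span_singleton_self e)))

/-- Let `γ > 0` and `0 < δ < 2`, `δ ≠ 1` be real numbers, and `e, f`
idempotents of central charge `γ`, each with the fusion property of binary type with
respect to `δ`, with `f ∈ B^e(0) ⊕ B^e(δ) ⊕ ℂe` and `e ∈ B^f(0) ⊕ B^f(δ) ⊕ ℂf`.  Then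
either `(e|f) = γ/2` and `e = f`, or `(e|f) = 0` and `e·f = 0`, or `(e|f) = δγ/8` and
`σ_e(f) = σ_f(e)`. -/
theorem stmt_4 {B : Type*} [AddCommGroup B] [Module ℂ B]
    (mul : B →ₗ[ℂ] B →ₗ[ℂ] B) (hcomm : ∀ x y : B, mul x y = mul y x)
    (form : B →ₗ[ℂ] B →ₗ[ℂ] ℂ) (hsymm : ∀ x y : B, form x y = form y x)
    (hinv : ∀ a x y : B, form (mul a x) y = form x (mul a y))
    (γ δ : ℝ) (hγ : 0 < γ) (hδ0 : 0 < δ) (hδ2 : δ < 2) (hδ1 : δ ≠ 1)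
    (e f : B)
    (he : mul e e = (2 : ℂ) • e) (hcce : 2 * form e e = (γ : ℂ))
    (hf : mul f f = (2 : ℂ) • f) (hccf : 2 * form f f = (γ : ℂ))
    (hfuse : HasFusion mul form e (δ : ℂ)) (hfusf : HasFusion mul form f (δ : ℂ))
    (f₀ fδ : B) (cf : ℂ)
    (hf₀ : f₀ ∈ eigSp mul form e 0) (hfδ : fδ ∈ eigSp mul form e (δ : ℂ))
    (hfdec : f = f₀ + fδ + cf • e)
    (e₀ eδ : B) (ce : ℂ)
    (he₀ : e₀ ∈ eigSp mul form f 0) (heδ : eδ ∈ eigSp mul form f (δ : ℂ))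
    (hedec : e = e₀ + eδ + ce • f) :
    (form e f = (γ : ℂ) / 2 ∧ e = f) ∨
    (form e f = 0 ∧ mul e f = 0) ∨
    (form e f = ((δ * γ / 8 : ℝ) : ℂ) ∧ f - (2 : ℂ) • fδ = e - (2 : ℂ) • eδ) := by
  have hγ' : (γ : ℂ) ≠ 0 := by exact_mod_cast hγ.ne'
  have hδ : (δ : ℂ) ≠ 0 := by exact_mod_cast hδ0.ne'
  have hδ' : (δ : ℂ) - 1 ≠ 0 := sub_ne_zero.2 (by exact_mod_cast hδ1)
  have hee : form e e = (γ : ℂ) / 2 := by linear_combination hcce / 2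
  have hff : form f f = (γ : ℂ) / 2 := by linear_combination hccf / 2
  have hee0 : form e e ≠ 0 := by rw [hee]; exact div_ne_zero hγ' two_ne_zero
  have hff0 : form f f ≠ 0 := by rw [hff]; exact div_ne_zero hγ' two_ne_zero
  have hform : form e f = cf * (γ / 2) := by
    rw [hfdec, map_add, map_add, map_smul, hf₀.1, hfδ.1, hee, smul_eq_mul]
    ring
  have hform' : form f e = ce * (γ / 2) := by
    rw [hedec, map_add, map_add, map_smul, he₀.1, heδ.1, hff, smul_eq_mul]
    ring
  obtain rfl : cf = ce :=
    mul_right_cancel₀ (div_ne_zero hγ' two_ne_zero) (hform.symm.trans ((hsymm e f).trans hform'))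
  have hef := mul_eq_of_decomposition he hf₀ hfδ hfdec
  have hfe := mul_eq_of_decomposition hf he₀ heδ hedec
  have hp : (δ : ℂ) • fδ + (2 * cf) • e = (δ : ℂ) • eδ + (2 * cf) • f := by
    rw [← hef, ← hfe, hcomm]
  by_cases hc : (δ : ℂ) - 4 * cf = 0
  · refine Or.inr (Or.inr ⟨?_, ?_⟩)
    · rw [hform]
      push_cast
      linear_combination (-(γ : ℂ) / 8) * hc
    · refine smul_right_injective B hδ ?_
      have hc' : (δ : ℂ) = 4 * cf := sub_eq_zero.1 hc
      simp only [hc'] at hp ⊢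
      linear_combination (norm := module) (-2 : ℂ) • hp
  · have hfz : fδ = 0 := (smul_eq_zero.1 (smul_component_eq_zero hcomm hee0 hδ he hf hfuse
      hf₀ hfδ hfdec heδ.2 hfe)).resolve_left (mul_ne_zero hδ' hc)
    have hez : eδ = 0 := (smul_eq_zero.1 (smul_component_eq_zero hcomm hff0 hδ hf he hfusf
      he₀ heδ hedec hfδ.2 hef)).resolve_left (mul_ne_zero hδ' hc)
    by_cases hc0 : cf = 0
    · exact Or.inr (Or.inl ⟨by rw [hform, hc0, zero_mul], by rw [hef, hfz, hc0]; simp⟩)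
    · have heq : e = f := by
        rw [hfz, hez, smul_zero, zero_add, zero_add] at hp
        exact smul_right_injective B (mul_ne_zero two_ne_zero hc0) hp
      exact Or.inl ⟨by rw [← heq, hee], heq⟩
end

section
/- Let G be the subgroup of the group of form-preserving algebra automorphisms of B generated by {σ_e : e ∈ E}. Then the center of G equals the kernel of the action of G on E, i.e. Z(G) = {τ ∈ G : τ(e) = e for all e ∈ E}. -/
variable {B : Type*} [AddCommGroup B] [Module ℂ B]

/-- `σ` is the involution `σ_e` attached to the idempotent `e`: it is the identity on
`B_e[0] = B^e(0) ⊕ ℂe` and `−1` on `B_e[1] = B^e(δ)`; it is then a form-preserving algebra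
automorphism of `B`. -/
def IsSigma (mul : B →ₗ[ℂ] B →ₗ[ℂ] B) (form : B →ₗ[ℂ] B →ₗ[ℂ] ℂ) (δ : ℂ) (e : B)
    (σ : B ≃ₗ[ℂ] B) : Prop :=
  (∀ x ∈ beBar mul form e, σ x = x) ∧
  (∀ x ∈ eigSp mul form e δ, σ x = -x) ∧
  (∀ x y : B, σ (mul x y) = mul (σ x) (σ y)) ∧
  (∀ x y : B, form (σ x) (σ y) = form x y)

/-- `e ∈ E`: `e` is an idempotent of central charge `γ` such that
`B = B^e(0) ⊕ B^e(δ) ⊕ ℂe` and `e` has the fusion property of binary type w.r.t. `δ`. -/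
def memE (mul : B →ₗ[ℂ] B →ₗ[ℂ] B) (form : B →ₗ[ℂ] B →ₗ[ℂ] ℂ) (γ δ : ℝ) (e : B) : Prop :=
  mul e e = (2 : ℂ) • e ∧ 2 * form e e = (γ : ℂ) ∧
  HasFusion mul form e (δ : ℂ) ∧
  eigSp mul form e 0 ⊔ eigSp mul form e (δ : ℂ) ⊔ Submodule.span ℂ {e} = ⊤

/-- The set `D = {σ_e : e ∈ E}` inside the group of (form-preserving algebra)
automorphisms of `B`. -/
def setD (mul : B →ₗ[ℂ] B →ₗ[ℂ] B) (form : B →ₗ[ℂ] B →ₗ[ℂ] ℂ) (γ δ : ℝ) :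
    Set (B ≃ₗ[ℂ] B) :=
  {σ | ∃ e : B, memE mul form γ δ e ∧ IsSigma mul form (δ : ℂ) e σ}

section BinaryFusion

variable {mul : B →ₗ[ℂ] B →ₗ[ℂ] B} {form : B →ₗ[ℂ] B →ₗ[ℂ] ℂ}

lemma mem_beBar_iff {e p : B} :
    p ∈ beBar mul form e ↔ ∃ x ∈ eigSp mul form e 0, ∃ k : ℂ, p = x + k • e := by
  simp only [beBar, Submodule.mem_sup, Submodule.mem_span_singleton]
  constructor
  · rintro ⟨x, hx, _, ⟨k, rfl⟩, rfl⟩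
    exact ⟨x, hx, k, rfl⟩
  · rintro ⟨x, hx, k, rfl⟩
    exact ⟨x, hx, _, ⟨k, rfl⟩, rfl⟩

lemma self_mem_beBar (e : B) : e ∈ beBar mul form e :=
  mem_beBar_iff.2 ⟨0, zero_mem _, 1, by simp⟩

lemma memE.exists_add_eq {γ δ : ℝ} {e : B} (he : memE mul form γ δ e) (b : B) :
    ∃ p ∈ beBar mul form e, ∃ q ∈ eigSp mul form e (δ : ℂ), b = p + q := by
  have hb : b ∈ eigSp mul form e 0 ⊔ eigSp mul form e (δ : ℂ) ⊔ Submodule.span ℂ {e} := by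
    rw [he.2.2.2]; trivial
  rw [sup_right_comm] at hb
  obtain ⟨p, hp, q, hq, rfl⟩ := Submodule.mem_sup.1 hb
  exact ⟨p, hp, q, hq, rfl⟩

lemma memE.form_self {γ δ : ℝ} {e : B} (he : memE mul form γ δ e) :
    form e e = (γ : ℂ) / 2 := by
  rw [← he.2.1]; ring

/-- On `B_e[0]` multiplication by `e` is a multiple of the projection to `ℂe`. -/
lemma memE.mul_of_mem_beBar {γ δ : ℝ} (hγ : 0 < γ) {e p : B} (he : memE mul form γ δ e)
    (hp : p ∈ beBar mul form e) : mul e p = (4 * form e p / γ) • e := by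
  have hγ' : (γ : ℂ) ≠ 0 := by exact_mod_cast hγ.ne'
  obtain ⟨x, hx, k, rfl⟩ := mem_beBar_iff.1 hp
  simp only [map_add, map_smul, hx.1, hx.2, he.1, he.form_self, smul_eq_mul, zero_smul, zero_add,
    smul_smul]
  congr 1
  field_simp
  ring

lemma memE.eq_zero_of_mem {γ δ : ℝ} (hγ : 0 < γ) (hδ : 0 < δ) {e v : B}
    (he : memE mul form γ δ e) (hp : v ∈ beBar mul form e)
    (hq : v ∈ eigSp mul form e (δ : ℂ)) : v = 0 := by
  have h := he.mul_of_mem_beBar hγ hp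
  rw [hq.1, hq.2] at h
  simpa [hδ.ne'] using h

lemma IsSigma.apply_add {δ : ℂ} {e p q : B} {σ : B ≃ₗ[ℂ] B} (hσ : IsSigma mul form δ e σ)
    (hp : p ∈ beBar mul form e) (hq : q ∈ eigSp mul form e δ) : σ (p + q) = p - q := by
  rw [map_add, hσ.1 p hp, hσ.2.1 q hq, sub_eq_add_neg]

lemma IsSigma.unique {γ δ : ℝ} {e : B} (he : memE mul form γ δ e) {σ σ' : B ≃ₗ[ℂ] B}
    (hσ : IsSigma mul form (δ : ℂ) e σ) (hσ' : IsSigma mul form (δ : ℂ) e σ') : σ = σ' := by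
  ext b
  obtain ⟨p, hp, q, hq, rfl⟩ := he.exists_add_eq b
  rw [hσ.apply_add hp hq, hσ'.apply_add hp hq]

lemma IsSigma.smul_apply {γ δ : ℝ} (hγ : 0 < γ) {e : B} (he : memE mul form γ δ e)
    {σ : B ≃ₗ[ℂ] B} (hσ : IsSigma mul form (δ : ℂ) e σ) (b : B) :
    (δ : ℂ) • σ b = (δ : ℂ) • b - (2 : ℂ) • mul e b + (8 * form e b / γ) • e := by
  obtain ⟨p, hp, q, hq, rfl⟩ := he.exists_add_eq b
  rw [hσ.apply_add hp hq]
  simp only [map_add, hq.1, hq.2, he.mul_of_mem_beBar hγ hp]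
  module

/-- The involution `σ_e` exists for every `e ∈ E`. -/
lemma memE.exists_isSigma (hsymm : ∀ x y : B, form x y = form y x)
    (hinv : ∀ a x y : B, form (mul a x) y = form x (mul a y))
    {γ δ : ℝ} (hγ : 0 < γ) (hδ : 0 < δ) {e : B}
    (he : memE mul form γ δ e) : ∃ σ : B ≃ₗ[ℂ] B, IsSigma mul form (δ : ℂ) e σ := by
  have hδ' : (δ : ℂ) ≠ 0 := by exact_mod_cast hδ.ne'
  have hγ' : (γ : ℂ) ≠ 0 := by exact_mod_cast hγ.ne'
  let s : B →ₗ[ℂ] B :=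
    LinearMap.id - (2 / (δ : ℂ)) • mul e + (8 / (δ * γ : ℂ)) • (form e).smulRight e
  have hs : ∀ p ∈ beBar mul form e, ∀ q ∈ eigSp mul form e (δ : ℂ), s (p + q) = p - q := by
    intro p hp q hq
    simp only [s, LinearMap.add_apply, LinearMap.sub_apply, LinearMap.smul_apply,
      LinearMap.id_apply, LinearMap.smulRight_apply, map_add, hq.1, hq.2,
      he.mul_of_mem_beBar hγ hp, smul_smul]
    rw [div_mul_cancel₀ _ hδ', show 2 / (δ : ℂ) * (4 * form e p / γ) =
      8 / (δ * γ : ℂ) * form e p by field_simp; ring]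
    module
  have hinvol : Function.Involutive s := by
    intro b
    obtain ⟨p, hp, q, hq, rfl⟩ := he.exists_add_eq b
    rw [hs p hp q hq, sub_eq_add_neg, hs p hp _ (neg_mem hq), sub_neg_eq_add]
  have horth : ∀ p ∈ beBar mul form e, ∀ q ∈ eigSp mul form e (δ : ℂ), form p q = 0 := by
    intro p hp q hq
    have h := hinv e p q
    rw [hq.2, he.mul_of_mem_beBar hγ hp] at h
    simpa [hq.1, hδ'] using h
  refine ⟨LinearEquiv.ofInvolutive s hinvol, ?_, ?_, ?_, ?_⟩
  · intro x hx
    simpa using hs x hx 0 (zero_mem _)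
  · intro x hx
    simpa using hs 0 (zero_mem _) x hx
  · intro x y
    change s _ = mul (s x) (s y)
    obtain ⟨p, hp, q, hq, rfl⟩ := he.exists_add_eq x
    obtain ⟨p', hp', q', hq', rfl⟩ := he.exists_add_eq y
    obtain ⟨f1, f2, f3, f4⟩ := he.2.2.1
    have h := hs _ (add_mem (f1 p hp p' hp') (f4 q hq q' hq'))
      _ (add_mem (f2 p hp q' hq') (f3 q hq p' hp'))
    rw [hs p hp q hq, hs p' hp' q' hq']
    rw [show mul (p + q) (p' + q') = mul p p' + mul q q' + (mul p q' + mul q p') by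
      simp only [map_add, LinearMap.add_apply]; abel, h]
    simp only [map_sub, LinearMap.sub_apply]
    abel
  · intro x y
    change form (s x) (s y) = _
    obtain ⟨p, hp, q, hq, rfl⟩ := he.exists_add_eq x
    obtain ⟨p', hp', q', hq', rfl⟩ := he.exists_add_eq y
    rw [hs p hp q hq, hs p' hp' q' hq']
    simp only [map_sub, map_add, LinearMap.sub_apply, LinearMap.add_apply, horth p hp q' hq',
      hsymm q p', horth p' hp' q hq]
    ring

/-- Unless `(a|b) = γδ/8`, the involution `σ_a` fixes `b`. -/
lemma IsSigma.apply_eq_self (hcomm : ∀ x y : B, mul x y = mul y x)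
    (hsymm : ∀ x y : B, form x y = form y x)
    {γ δ : ℝ} (hγ : 0 < γ) (hδ : 0 < δ) (hδ1 : δ ≠ 1) {a b : B}
    (ha : memE mul form γ δ a) (hb : memE mul form γ δ b)
    {σ : B ≃ₗ[ℂ] B} (hσ : IsSigma mul form (δ : ℂ) a σ)
    (hab : 8 * form a b / γ ≠ δ) : σ b = b := by
  set l : ℂ := 2 * form a b / γ with hl
  obtain ⟨p, hp, y, hy, hbpy⟩ := ha.exists_add_eq b
  have hmulab : mul a b = (2 * l) • a + (δ : ℂ) • y := by
    have h : form a b = form a p := by rw [hbpy, map_add, hy.1, add_zero]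
    rw [hl, h, hbpy, map_add, hy.2, ha.mul_of_mem_beBar hγ hp]
    congr 2
    ring
  -- the decomposition of `a` with respect to `b` determines `b · (b · a)`
  have hbab : mul b (mul a b) = (δ : ℂ) • mul a b + (2 * l * (2 - δ)) • b := by
    obtain ⟨p', hp', y', hy', hapy⟩ := hb.exists_add_eq a
    have h : form a b = form b p' := by rw [hsymm, hapy, map_add, hy'.1, add_zero]
    have hba : mul a b = (2 * l) • b + (δ : ℂ) • y' := by
      rw [hcomm, hl, h]
      conv_lhs => rw [hapy]
      rw [map_add, hy'.2, hb.mul_of_mem_beBar hγ hp']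
      congr 2
      ring
    rw [hba]
    simp only [map_add, map_smul, hb.1, hy'.2]
    module
  obtain ⟨f1, f2, f3, f4⟩ := ha.2.2.1
  have hpy : mul p y = y := by
    have hbb := hb.1
    rw [hbpy] at hbb
    simp only [map_add, LinearMap.add_apply, hcomm y p] at hbb
    have hodd : (2 : ℂ) • (mul p y - y) = -(mul p p + mul y y - (2 : ℂ) • p) := by
      linear_combination (norm := module) hbb
    have h0 : (2 : ℂ) • (mul p y - y) = 0 := by
      refine ha.eq_zero_of_mem hγ hδ ?_ ?_
      · rw [hodd]
        exact neg_mem (sub_mem (add_mem (f1 p hp p hp) (f4 y hy y hy)) (Submodule.smul_mem _ _ hp))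
      · exact Submodule.smul_mem _ _ (sub_mem (f2 p hp y hy) hy)
    exact sub_eq_zero.1 ((smul_eq_zero.1 h0).resolve_left two_ne_zero)
  have hby : mul b y = y + mul y y := by
    conv_lhs => rw [hbpy]
    rw [map_add, LinearMap.add_apply, hpy]
  have hyy : (((δ : ℂ) - 1) * (δ - 4 * l)) • y =
      (δ : ℂ) • mul y y - (2 * l * (2 - δ)) • p - (2 * l * (δ - 2 * l)) • a := by
    have h := hbab
    rw [hmulab, map_add, map_smul, map_smul, hcomm b a, hmulab, hby, hbpy] at h
    linear_combination (norm := module) -h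
  have h0 : (((δ : ℂ) - 1) * (δ - 4 * l)) • y = 0 := by
    refine ha.eq_zero_of_mem hγ hδ ?_ (Submodule.smul_mem _ _ hy)
    rw [hyy]
    exact sub_mem (sub_mem (Submodule.smul_mem _ _ (f4 y hy y hy)) (Submodule.smul_mem _ _ hp))
      (Submodule.smul_mem _ _ (self_mem_beBar a))
  have hy0 : y = 0 := by
    refine (smul_eq_zero.1 h0).resolve_left (mul_ne_zero ?_ ?_)
    · exact sub_ne_zero.2 (by exact_mod_cast hδ1)
    · refine sub_ne_zero.2 fun h => hab ?_
      rw [h, hl]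
      ring
  rw [hbpy, hσ.apply_add hp hy, hy0, sub_zero, add_zero]

/-- If `σ_b` moves `a`, then `σ_a b = σ_b a`. -/
lemma IsSigma.apply_eq_apply (hcomm : ∀ x y : B, mul x y = mul y x)
    (hsymm : ∀ x y : B, form x y = form y x)
    {γ δ : ℝ} (hγ : 0 < γ) (hδ : 0 < δ) (hδ1 : δ ≠ 1) {a b : B}
    (ha : memE mul form γ δ a) (hb : memE mul form γ δ b) {σa σb : B ≃ₗ[ℂ] B}
    (hσa : IsSigma mul form (δ : ℂ) a σa) (hσb : IsSigma mul form (δ : ℂ) b σb)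
    (hne : σb a ≠ a) : σa b = σb a := by
  have hδ' : (δ : ℂ) ≠ 0 := by exact_mod_cast hδ.ne'
  have hform : 8 * form b a / γ = (δ : ℂ) := by
    by_contra h
    exact hne (hσb.apply_eq_self hcomm hsymm hγ hδ hδ1 hb ha h)
  refine smul_right_injective B hδ' ?_
  simp only [hσa.smul_apply hγ ha, hσb.smul_apply hγ hb, hcomm b a, hsymm a b, hform]
  abel

lemma apply_mem_eigSp_iff {τ : B ≃ₗ[ℂ] B} (hmul : ∀ x y : B, τ (mul x y) = mul (τ x) (τ y))
    (hform : ∀ x y : B, form (τ x) (τ y) = form x y) {e v : B} {h : ℂ} :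
    τ v ∈ eigSp mul form (τ e) h ↔ v ∈ eigSp mul form e h := by
  change _ ∧ _ ↔ _ ∧ _
  rw [hform, ← hmul, ← map_smul, τ.injective.eq_iff]

lemma eigSp_apply {τ : B ≃ₗ[ℂ] B} (hmul : ∀ x y : B, τ (mul x y) = mul (τ x) (τ y))
    (hform : ∀ x y : B, form (τ x) (τ y) = form x y) (e : B) (h : ℂ) :
    eigSp mul form (τ e) h = (eigSp mul form e h).map (τ : B →ₗ[ℂ] B) := by
  ext v
  obtain ⟨v, rfl⟩ := τ.surjective v
  rw [apply_mem_eigSp_iff hmul hform]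
  exact (τ.injective.mem_set_image (s := (eigSp mul form e h : Set B))).symm

lemma apply_mem_beBar_iff {τ : B ≃ₗ[ℂ] B} (hmul : ∀ x y : B, τ (mul x y) = mul (τ x) (τ y))
    (hform : ∀ x y : B, form (τ x) (τ y) = form x y) {e v : B} :
    τ v ∈ beBar mul form (τ e) ↔ v ∈ beBar mul form e := by
  simp only [mem_beBar_iff]
  constructor
  · rintro ⟨x, hx, k, h⟩
    obtain ⟨x, rfl⟩ := τ.surjective x
    refine ⟨x, (apply_mem_eigSp_iff hmul hform).1 hx, k, τ.injective ?_⟩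
    rw [h, map_add, map_smul]
  · rintro ⟨x, hx, k, rfl⟩
    exact ⟨τ x, (apply_mem_eigSp_iff hmul hform).2 hx, k, by rw [map_add, map_smul]⟩

lemma memE.apply {τ : B ≃ₗ[ℂ] B} (hmul : ∀ x y : B, τ (mul x y) = mul (τ x) (τ y))
    (hform : ∀ x y : B, form (τ x) (τ y) = form x y) {γ δ : ℝ} {e : B}
    (he : memE mul form γ δ e) : memE mul form γ δ (τ e) := by
  obtain ⟨h1, h2, ⟨f1, f2, f3, f4⟩, h4⟩ := he
  refine ⟨by rw [← hmul, h1, map_smul], by rw [hform, h2], ?_, ?_⟩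
  · refine ⟨?_, ?_, ?_, ?_⟩ <;> refine τ.surjective.forall.2 fun x => ?_ <;>
      refine fun hx => τ.surjective.forall.2 fun y => ?_ <;>
      simp only [← hmul, apply_mem_beBar_iff hmul hform, apply_mem_eigSp_iff hmul hform] at hx ⊢
    exacts [f1 x hx y, f2 x hx y, f3 x hx y, f4 x hx y]
  · have hspan : Submodule.span ℂ {τ e} = (Submodule.span ℂ {e}).map (τ : B →ₗ[ℂ] B) := by
      rw [Submodule.map_span, Set.image_singleton]; rfl
    rw [eigSp_apply hmul hform, eigSp_apply hmul hform, hspan, ← Submodule.map_sup,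
      ← Submodule.map_sup, h4, Submodule.map_top, LinearEquiv.range]

lemma IsSigma.conj {τ : B ≃ₗ[ℂ] B} (hmul : ∀ x y : B, τ (mul x y) = mul (τ x) (τ y))
    (hform : ∀ x y : B, form (τ x) (τ y) = form x y) {δ : ℂ} {e : B} {σ ρ : B ≃ₗ[ℂ] B}
    (hσ : IsSigma mul form δ e σ) (hρ : ρ * τ = τ * σ) : IsSigma mul form δ (τ e) ρ := by
  have h : ∀ x, ρ (τ x) = τ (σ x) := fun x => LinearEquiv.congr_fun hρ x
  obtain ⟨h1, h2, h3, h4⟩ := hσ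
  refine ⟨τ.surjective.forall.2 fun x hx => ?_, τ.surjective.forall.2 fun x hx => ?_,
    τ.surjective.forall₂.2 fun x y => ?_, τ.surjective.forall₂.2 fun x y => ?_⟩
  · rw [h, h1 x ((apply_mem_beBar_iff hmul hform).1 hx)]
  · rw [h, h2 x ((apply_mem_eigSp_iff hmul hform).1 hx), map_neg]
  · rw [← hmul, h, h, h, h3, hmul]
  · rw [h, h, hform, hform, h4]

/-- The elements of `G` are form-preserving algebra automorphisms. -/
lemma map_mul_and_form_of_mem_closure {γ δ : ℝ} {τ : B ≃ₗ[ℂ] B}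
    (hτ : τ ∈ Subgroup.closure (setD mul form γ δ)) :
    (∀ x y : B, τ (mul x y) = mul (τ x) (τ y)) ∧
      ∀ x y : B, form (τ x) (τ y) = form x y := by
  induction hτ using Subgroup.closure_induction with
  | mem σ h =>
    obtain ⟨_, _, hσ⟩ := h
    exact hσ.2.2
  | one => exact ⟨fun _ _ => rfl, fun _ _ => rfl⟩
  | mul σ ρ _ _ hσ hρ =>
    simp only [LinearEquiv.mul_apply]
    exact ⟨fun x y => by rw [hρ.1, hσ.1], fun x y => by rw [hσ.2, hρ.2]⟩
  | inv σ _ hσ =>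
    have h : ∀ x, σ (σ⁻¹ x) = x := fun x => σ.apply_symm_apply x
    exact ⟨fun x y => σ.injective (by rw [hσ.1, h, h, h]), fun x y => by rw [← hσ.2, h, h]⟩

end BinaryFusion

/-- Let `G` be the subgroup of the group of form-preserving algebra
automorphisms of `B` generated by `{σ_e : e ∈ E}`.  Then the center of `G` equals the
kernel of the action of `G` on `E`: an element `τ ∈ G` is central (commutes with every
element of `G`) if and only if `τ(e) = e` for all `e ∈ E`. -/
theorem stmt_8 {B : Type*} [AddCommGroup B] [Module ℂ B]
    (mul : B →ₗ[ℂ] B →ₗ[ℂ] B) (hcomm : ∀ x y : B, mul x y = mul y x)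
    (form : B →ₗ[ℂ] B →ₗ[ℂ] ℂ) (hsymm : ∀ x y : B, form x y = form y x)
    (hinv : ∀ a x y : B, form (mul a x) y = form x (mul a y))
    (γ δ : ℝ) (hγ : 0 < γ) (hδ0 : 0 < δ) (hδ2 : δ < 2) (hδ1 : δ ≠ 1) :
    ∀ τ : B ≃ₗ[ℂ] B, τ ∈ Subgroup.closure (setD mul form γ δ) →
      ((∀ g ∈ Subgroup.closure (setD mul form γ δ), τ * g = g * τ) ↔
        (∀ e : B, memE mul form γ δ e → τ e = e)) := by
  intro τ hτ
  obtain ⟨hmul, hform⟩ := map_mul_and_form_of_mem_closure hτ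
  constructor
  · intro hcentral e he
    by_contra hne
    obtain ⟨ρ, ⟨g, hg, hρ⟩, hρe⟩ : ∃ ρ ∈ setD mul form γ δ, ρ e ≠ e := by
      by_contra! hfix
      have hle : Subgroup.closure (setD mul form γ δ) ≤ MulAction.stabilizer (B ≃ₗ[ℂ] B) e :=
        (Subgroup.closure_le _).2 hfix
      exact hne (hle hτ)
    obtain ⟨σ, hσ⟩ := he.exists_isSigma hsymm hinv hγ hδ0
    have hστ := hcentral σ (Subgroup.subset_closure ⟨e, he, hσ⟩)
    have hρτ : τ (ρ e) = ρ (τ e) :=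
      LinearEquiv.congr_fun (hcentral ρ (Subgroup.subset_closure ⟨g, hg, hρ⟩)) e
    have hmoves : ρ (τ e) ≠ τ e := by
      rw [← hρτ]
      exact τ.injective.ne hρe
    have h1 := hσ.apply_eq_apply hcomm hsymm hγ hδ0 hδ1 he hg hρ hρe
    have h2 := (hσ.conj hmul hform hστ.symm).apply_eq_apply hcomm hsymm hγ hδ0 hδ1
      (he.apply hmul hform) hg hρ hmoves
    exact hne (ρ.injective (h2.symm.trans h1))
  · intro hfix g hg
    suffices h : Subgroup.closure (setD mul form γ δ) ≤ Subgroup.centralizer {τ} from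
      Subgroup.mem_centralizer_singleton_iff.1 (h hg) |>.symm
    refine (Subgroup.closure_le _).2 ?_
    rintro σ ⟨e, he, hσ⟩
    have hconj := hσ.conj hmul hform (ρ := τ * σ * τ⁻¹) (by group)
    rw [hfix e he] at hconj
    refine Subgroup.mem_centralizer_singleton_iff.2 ?_
    nth_rewrite 1 [hσ.unique he hconj]
    group
end

section
/- Suppose that for every e ∈ E there exists g ∈ E with (e|g) = δγ/8. Then the map E → Aut(B), e ↦ σ_e, is injective: if e, f ∈ E and σ_e = σ_f as automorphisms of B, then e = f. -/
variable {B : Type*} [AddCommGroup B] [Module ℂ B]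

/-- Every vector decomposes along `B = B^e(0) ⊕ B^e(δ) ⊕ ℂe`. -/
theorem memE.exists_decomp {mul : B →ₗ[ℂ] B →ₗ[ℂ] B} {form : B →ₗ[ℂ] B →ₗ[ℂ] ℂ} {γ δ : ℝ} {e : B}
    (he : memE mul form γ δ e) (y : B) :
    ∃ p ∈ eigSp mul form e 0, ∃ q ∈ eigSp mul form e (δ : ℂ), ∃ c : ℂ, y = p + q + c • e := by
  have hy : y ∈ eigSp mul form e 0 ⊔ eigSp mul form e (δ : ℂ) ⊔ Submodule.span ℂ {e} := by
    rw [he.2.2.2]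
    exact Submodule.mem_top
  obtain ⟨w, hw, r, hr, rfl⟩ := Submodule.mem_sup.1 hy
  obtain ⟨p, hp, q, hq, rfl⟩ := Submodule.mem_sup.1 hw
  obtain ⟨c, rfl⟩ := Submodule.mem_span_singleton.1 hr
  exact ⟨p, hp, q, hq, c, rfl⟩

/-- The vector `e·(e·y) - δ e·y` is a multiple of `e`, with coefficient determined by `(e|y)`. -/
theorem memE.mul_mul_sub {mul : B →ₗ[ℂ] B →ₗ[ℂ] B} {form : B →ₗ[ℂ] B →ₗ[ℂ] ℂ} {γ δ : ℝ} {e : B}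
    (he : memE mul form γ δ e) {y : B} {a : ℂ} (hy : 2 * form e y = a * γ) (hγ : γ ≠ 0) :
    mul e (mul e y) - (δ : ℂ) • mul e y = (2 * (2 - δ) * a) • e := by
  obtain ⟨p, ⟨hp, hp'⟩, q, ⟨hq, hq'⟩, c, rfl⟩ := he.exists_decomp y
  obtain rfl : c = a := by
    have hγ' : (γ : ℂ) ≠ 0 := by exact_mod_cast hγ
    apply mul_right_cancel₀ hγ'
    rw [← hy, ← he.2.1]
    simp only [map_add, map_smul, hp, hq, smul_eq_mul]
    ring
  simp only [map_add, map_smul, hp', hq', he.1, zero_smul, map_zero]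
  module

/-- The product with `e` in terms of `(e|y)` and the involution `σ_e`. -/
theorem memE.mul_eq {mul : B →ₗ[ℂ] B →ₗ[ℂ] B} {form : B →ₗ[ℂ] B →ₗ[ℂ] ℂ} {γ δ : ℝ} {e : B}
    (he : memE mul form γ δ e) {σ : B ≃ₗ[ℂ] B} (hσ : IsSigma mul form (δ : ℂ) e σ)
    {y : B} {a : ℂ} (hy : 2 * form e y = a * γ) (hγ : γ ≠ 0) :
    mul e y = (2 * a) • e + ((δ : ℂ) / 2) • (y - σ y) := by
  obtain ⟨p, hp, q, hq, c, rfl⟩ := he.exists_decomp y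
  obtain rfl : c = a := by
    have hγ' : (γ : ℂ) ≠ 0 := by exact_mod_cast hγ
    apply mul_right_cancel₀ hγ'
    rw [← hy, ← he.2.1]
    simp only [map_add, map_smul, hp.1, hq.1, smul_eq_mul]
    ring
  have h0 : σ (p + c • e) = p + c • e := hσ.1 _ (Submodule.add_mem_sup hp
    (Submodule.smul_mem _ _ (Submodule.mem_span_singleton_self e)))
  have h1 : σ (p + q + c • e) = p - q + c • e := by
    rw [show p + q + c • e = p + c • e + q by abel, map_add, h0, hσ.2.1 q hq]
    abel
  rw [h1]
  simp only [map_add, map_smul, hp.2, hq.2, he.1, zero_smul]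
  module

theorem IsSigma.apply_self {mul : B →ₗ[ℂ] B →ₗ[ℂ] B} {form : B →ₗ[ℂ] B →ₗ[ℂ] ℂ} {δ : ℂ} {e : B}
    {σ : B ≃ₗ[ℂ] B} (hσ : IsSigma mul form δ e σ) : σ e = e :=
  hσ.1 e (Submodule.mem_sup_right (Submodule.mem_span_singleton_self e))

theorem IsSigma.apply_apply {mul : B →ₗ[ℂ] B →ₗ[ℂ] B} {form : B →ₗ[ℂ] B →ₗ[ℂ] ℂ} {γ δ : ℝ} {e : B}
    {σ : B ≃ₗ[ℂ] B} (hσ : IsSigma mul form (δ : ℂ) e σ) (he : memE mul form γ δ e) (y : B) :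
    σ (σ y) = y := by
  obtain ⟨p, hp, q, hq, c, rfl⟩ := he.exists_decomp y
  have hp' : σ p = p := hσ.1 p (Submodule.mem_sup_left hp)
  simp only [map_add, map_smul, hp', hσ.2.1 q hq, hσ.apply_self, map_neg, neg_neg]

/-- Suppose that for every `e ∈ E` there exists `g ∈ E` with `(e|g) = δγ/8`.
Then the map `E → Aut(B)`, `e ↦ σ_e`, is injective: if `e, f ∈ E` and `σ_e = σ_f`, then
`e = f`. -/
theorem stmt_9 {B : Type*} [AddCommGroup B] [Module ℂ B]
    (mul : B →ₗ[ℂ] B →ₗ[ℂ] B) (hcomm : ∀ x y : B, mul x y = mul y x)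
    (form : B →ₗ[ℂ] B →ₗ[ℂ] ℂ) (hsymm : ∀ x y : B, form x y = form y x)
    (hinv : ∀ a x y : B, form (mul a x) y = form x (mul a y))
    (γ δ : ℝ) (hγ : 0 < γ) (hδ0 : 0 < δ) (hδ2 : δ < 2) (hδ1 : δ ≠ 1)
    (hex : ∀ e : B, memE mul form γ δ e →
      ∃ g : B, memE mul form γ δ g ∧ form e g = ((δ * γ / 8 : ℝ) : ℂ)) :
    ∀ e f : B, memE mul form γ δ e → memE mul form γ δ f →
      ∀ σe σf : B ≃ₗ[ℂ] B, IsSigma mul form (δ : ℂ) e σe → IsSigma mul form (δ : ℂ) f σf →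
        σe = σf → e = f := by
  intro e f he hf σ σf hσe hσf hσ
  subst hσ
  have hγ0 := hγ.ne'
  have hγC : (γ : ℂ) ≠ 0 := by exact_mod_cast hγ0
  have hδC : (δ : ℂ) ≠ 0 := by exact_mod_cast hδ0.ne'
  have hδC1 : (δ : ℂ) - 1 ≠ 0 := sub_ne_zero.2 (by exact_mod_cast hδ1)
  have hδC4 : (δ : ℂ) - 4 ≠ 0 := sub_ne_zero.2 (by
    have : δ ≠ 4 := by linarith
    exact_mod_cast this)
  obtain ⟨g, hg, heg⟩ := hex e he
  obtain ⟨b, hb⟩ : ∃ b : ℂ, 2 * form f g = b * γ :=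
    ⟨2 * form f g / γ, by field_simp⟩
  have ha : 2 * form e g = ((δ : ℂ) / 4) * γ := by
    rw [heg]
    push_cast
    ring
  have key : ∀ {h : B} {a : ℂ}, memE mul form γ δ h → IsSigma mul form (δ : ℂ) h σ →
      2 * form h g = a * γ →
      (2 * a - δ) • ((2 * a) • h + ((δ : ℂ) / 2) • (g - σ g)) + ((δ : ℂ) / 2) • mul g (g - σ g) =
        (2 * (2 - δ) * a) • g := by
    intro h a hh hσh hha
    have h1 := hg.mul_mul_sub (y := h) (by rw [hsymm, hha]) hγ0
    have h2 : mul g h = (2 * a) • h + ((δ : ℂ) / 2) • (g - σ g) := by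
      rw [hcomm, hh.mul_eq hσh hha hγ0]
    have h3 : mul g (mul g h) = (2 * a) • mul g h + ((δ : ℂ) / 2) • mul g (g - σ g) := by
      conv_lhs => rw [h2, map_add, map_smul, map_smul]
    rw [h3, h2] at h1
    rw [← h1]
    module
  have ke := key he hσe ha
  have kf := key hf hσf hb
  have hx : g - σ g ≠ 0 := by
    intro hx
    rw [hx] at ke
    simp only [smul_zero, add_zero, map_zero] at ke
    have h := congrArg (fun v => 2 * form e v) ke
    simp only [map_smul, smul_eq_mul] at h
    have h' : (δ : ℂ) * δ * (δ - 4) * γ = 0 := by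
      linear_combination (8 : ℂ) * h - 8 * (2 * (δ / 4) - δ) * (2 * (δ / 4)) * he.2.1
        + 8 * (2 * (2 - δ) * (δ / 4)) * ha
    simp_all
  have hdiff : ((2 * ((δ : ℂ) / 4) - δ) * (2 * (δ / 4))) • e - ((2 * b - δ) * (2 * b)) • f
      + (δ * (δ / 4 - b)) • (g - σ g) = (2 * (2 - δ) * (δ / 4 - b)) • g := by
    linear_combination (norm := module) ke - kf
  have hab : (δ : ℂ) / 4 = b := by
    by_contra hne
    have hfix := congrArg σ hdiff
    simp only [map_add, map_sub, map_smul, hσe.apply_self, hσf.apply_self] at hfix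
    rw [hσe.apply_apply he] at hfix
    have h0 : (4 * (δ - 1) * (δ / 4 - b)) • (g - σ g) = 0 := by
      linear_combination (norm := module) hdiff - hfix
    have := sub_ne_zero.2 hne
    simp_all
  subst hab
  have h0 : (-(δ : ℂ) * δ / 4) • (e - f) = 0 := by
    linear_combination (norm := module) hdiff
  have hc : (-(δ : ℂ) * δ / 4) ≠ 0 := by
    simp [hδC]
  exact sub_eq_zero.1 ((smul_eq_zero.1 h0).resolve_left hc)
end
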